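/- For each i ∈ [0, d)^ℕ, the sets C_0(i) = ⋃_{k∈ℕ} [α_k(i)] and C_∞(i) = ⋃_{k,p∈ℕ} [α_k(i) b^p] are directed hereditary subsets of Λ with C_0(i) ⊆ C_∞(i). The maximal elements, under inclusion, of the collection of nonempty directed hereditary subsets of Λ are exactly the sets C_∞(i) for i ∈ [0, d)^ℕ. Moreover, if C is a directed hereditary subset of Λ on which the height θ is unbounded, then there is a unique i ∈ [0, d)^ℕ with C ⊆ C_∞(i), and for this i one has C_0(i) ⊆ C. -/

import Mathlib

inductive BSGen : Type
  | a : BSGen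
  | b : BSGen

/-- The relations for the Baumslag–Solitar presentation `⟨a, b | a bᶜ = bᵉ a⟩`.
For cases (BS1), (BS2) take `e = d`; for case (BS3) take `e = -d`. -/
def BSRel (c e : ℤ) : Set (FreeGroup BSGen) :=
  {FreeGroup.of BSGen.a * FreeGroup.of BSGen.b ^ c *
    (FreeGroup.of BSGen.b ^ e * FreeGroup.of BSGen.a)⁻¹}

/-- The Baumslag–Solitar group `Γ = ⟨a, b | a bᶜ = bᵉ a⟩`. -/
abbrev BSGroup (c e : ℤ) := PresentedGroup (BSRel c e)

/-- The generator `a` of `Γ`. -/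
def bsa (c e : ℤ) : BSGroup c e := PresentedGroup.of BSGen.a

/-- The generator `b` of `Γ`. -/
def bsb (c e : ℤ) : BSGroup c e := PresentedGroup.of BSGen.b

/-- `Λ`, the submonoid of `Γ` generated by `a` and `b`. -/
def bsΛ (c e : ℤ) : Submonoid (BSGroup c e) :=
  Submonoid.closure {bsa c e, bsb c e}

/-- `[0, d)^ℕ`, the space of sequences with entries in `[0, d)`. -/
abbrev BSSeq (d : ℤ) := ℕ → (Set.Ico (0 : ℤ) d)

/-- For `i ∈ [0,d)^ℕ` and `k ∈ ℕ`, the element `α_k(i) = b^{i₀} a b^{i₁} a ⋯ b^{i_k} a`. -/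
def alphaSeq (c e d : ℤ) (i : BSSeq d) (k : ℕ) : BSGroup c e :=
  (List.ofFn (fun μ : Fin (k + 1) => bsb c e ^ ((i μ.1 : ℤ)) * bsa c e)).prod

/-- `[β] = {x ∈ Λ : β ∈ xΛ}`, the set of initial segments of `β` lying in `Λ`. -/
def seg (c e : ℤ) (β : BSGroup c e) : Set (BSGroup c e) :=
  {x | x ∈ bsΛ c e ∧ ∃ γ ∈ bsΛ c e, β = x * γ}

/-- `C₀(i) = ⋃_k [α_k(i)]`. -/
def C0 (c e d : ℤ) (i : BSSeq d) : Set (BSGroup c e) :=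
  ⋃ k : ℕ, seg c e (alphaSeq c e d i k)

/-- `C_∞(i) = ⋃_{k,p} [α_k(i) bᵖ]`. -/
def Cinf (c e d : ℤ) (i : BSSeq d) : Set (BSGroup c e) :=
  ⋃ k : ℕ, ⋃ p : ℕ, seg c e (alphaSeq c e d i k * bsb c e ^ p)

/-- `C` is a nonempty directed hereditary subset of `Λ`: any two elements of `C` have a
common extension in `C`, and any initial segment (in `Λ`) of an element of `C` lies in
`C`. -/
def IsDH (c e : ℤ) (C : Set (BSGroup c e)) : Prop :=
  C.Nonempty ∧ (∀ x ∈ C, x ∈ bsΛ c e) ∧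
  (∀ x ∈ C, ∀ y ∈ C, ∃ z ∈ C,
    (∃ γ ∈ bsΛ c e, z = x * γ) ∧ (∃ γ ∈ bsΛ c e, z = y * γ)) ∧
  (∀ β ∈ C, ∀ α ∈ bsΛ c e, (∃ γ ∈ bsΛ c e, β = α * γ) → α ∈ C)

namespace BaumslagSolitar

variable {c d e : ℤ}

/-- The product `b^{i₀} a b^{i₁} a ⋯ b^{i_{n-1}} a` attached to a list of exponents. -/
def stemProd (c e : ℤ) (l : List ℤ) : BSGroup c e :=
  (l.map fun i => bsb c e ^ i * bsa c e).prod

/-- `x` is an initial segment of `y`. -/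
abbrev Precedes (x y : BSGroup c e) : Prop := ∃ γ ∈ bsΛ c e, y = x * γ

/-- The list of the first `n` entries of `i`. -/
def initialList (i : BSSeq d) (n : ℕ) : List ℤ := (List.range n).map fun j => (i j : ℤ)

theorem bsa_mem : bsa c e ∈ bsΛ c e := Submonoid.subset_closure (by simp)

theorem bsb_mem : bsb c e ∈ bsΛ c e := Submonoid.subset_closure (by simp)

theorem bsb_zpow_mem {n : ℤ} (hn : 0 ≤ n) : bsb c e ^ n ∈ bsΛ c e := by
  lift n to ℕ using hn
  simpa using pow_mem bsb_mem n

theorem bsb_zpow_mul_bsa (n : ℤ) :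
    bsb c e ^ (e * n) * bsa c e = bsa c e * bsb c e ^ (c * n) := by
  have h : bsa c e * bsb c e ^ c = bsb c e ^ e * bsa c e := by
    rw [← mul_inv_eq_one]
    exact PresentedGroup.one_of_mem (rels := BSRel c e) rfl
  have h' : SemiconjBy (bsa c e) (bsb c e ^ c) (bsb c e ^ e) := h
  simpa [zpow_mul] using (h'.zpow_right n).eq.symm

section Precedes

variable {x y z : BSGroup c e}

theorem Precedes.refl (x : BSGroup c e) : Precedes x x := ⟨1, one_mem _, by simp⟩

theorem Precedes.trans (h : Precedes x y) (h' : Precedes y z) : Precedes x z := by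
  obtain ⟨γ, hγ, rfl⟩ := h
  obtain ⟨δ, hδ, rfl⟩ := h'
  exact ⟨γ * δ, mul_mem hγ hδ, by rw [mul_assoc]⟩

theorem precedes_mul_bsb_zpow (x : BSGroup c e) {p q : ℤ} (h : p ≤ q) :
    Precedes (x * bsb c e ^ p) (x * bsb c e ^ q) :=
  ⟨bsb c e ^ (q - p), bsb_zpow_mem (by lia), by rw [mul_assoc, ← zpow_add]; congr 2; ring⟩

end Precedes

@[simp]
theorem stemProd_nil : stemProd c e [] = 1 := rfl

@[simp]
theorem stemProd_cons (i : ℤ) (l : List ℤ) :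
    stemProd c e (i :: l) = bsb c e ^ i * bsa c e * stemProd c e l := rfl

@[simp]
theorem stemProd_append (l m : List ℤ) :
    stemProd c e (l ++ m) = stemProd c e l * stemProd c e m := by
  simp [stemProd]

theorem stemProd_mem {l : List ℤ} (hl : ∀ i ∈ l, i ∈ Set.Ico 0 d) : stemProd c e l ∈ bsΛ c e :=
  Submonoid.list_prod_mem _ <| by
    simp only [List.mem_map, forall_exists_index, and_imp, forall_apply_eq_imp_iff₂]
    exact fun i hi => mul_mem (bsb_zpow_mem (hl i hi).1) bsa_mem

theorem stemProd_mul_bsb_zpow_mul_bsa (l : List ℤ) (i q : ℤ) :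
    stemProd c e l * bsb c e ^ (i + e * q) * bsa c e =
      stemProd c e (l ++ [i]) * bsb c e ^ (c * q) := by
  rw [zpow_add, mul_assoc, mul_assoc, bsb_zpow_mul_bsa]
  simp [mul_assoc]

section Height

variable {θ : BSGroup c e → ℤ}

theorem height_stemProd_mul (hθ : ∀ x y, θ (x * y) = θ x + θ y)
    (hθa : θ (bsa c e) = 1) (hθb : θ (bsb c e) = 0) (l : List ℤ) (p : ℤ) :
    θ (stemProd c e l * bsb c e ^ p) = l.length := by
  let f : BSGroup c e →* Multiplicative ℤ :=
    MonoidHom.mk' (fun x => Multiplicative.ofAdd (θ x)) fun x y => by simp [hθ]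
  have hf (p : ℤ) : θ (bsb c e ^ p) = 0 := by
    have h : f (bsb c e ^ p) = 1 := by
      rw [map_zpow, show f (bsb c e) = 1 from congrArg Multiplicative.ofAdd hθb, one_zpow]
    exact congrArg Multiplicative.toAdd h
  induction l with
  | nil => simp [hf]
  | cons i l ih =>
    rw [stemProd_cons, mul_assoc, hθ, ih, hθ, hf, hθa]
    push_cast [List.length_cons]
    ring

end Height

section Britton

open HNNExtension Multiplicative

theorem zpowGroupHom_injective {n : ℤ} (hn : n ≠ 0) :
    Function.Injective (zpowGroupHom n : Multiplicative ℤ →* Multiplicative ℤ) := by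
  intro x y h
  exact zpow_left_injective hn h

/-- The isomorphism `cℤ ≃ eℤ` defining `Γ` as an HNN extension of `ℤ`. -/
noncomputable def associatedEquiv (hc : c ≠ 0) (he : e ≠ 0) :
    (zpowGroupHom c : Multiplicative ℤ →* Multiplicative ℤ).range ≃*
      (zpowGroupHom e : Multiplicative ℤ →* Multiplicative ℤ).range :=
  (MonoidHom.ofInjective (zpowGroupHom_injective hc)).symm.trans
    (MonoidHom.ofInjective (zpowGroupHom_injective he))

/-- The canonical map from `Γ` to the corresponding HNN extension. -/
noncomputable def toHNN (hc : c ≠ 0) (he : e ≠ 0) :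
    BSGroup c e →* HNNExtension (Multiplicative ℤ) _ _ (associatedEquiv hc he) :=
  PresentedGroup.toGroup (f := fun g => BSGen.casesOn g t (of (ofAdd 1))) <| by
    rintro r rfl
    have h := t_mul_of (φ := associatedEquiv hc he)
      (MonoidHom.ofInjective (zpowGroupHom_injective hc) (ofAdd 1))
    have h' : associatedEquiv hc he (MonoidHom.ofInjective (zpowGroupHom_injective hc) (ofAdd 1)) =
        MonoidHom.ofInjective (zpowGroupHom_injective he) (ofAdd 1) := by
      simp [associatedEquiv]
    rw [h', MonoidHom.ofInjective_apply, MonoidHom.ofInjective_apply] at h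
    simp only [map_mul, map_inv, map_zpow, FreeGroup.lift_apply_of, mul_inv_eq_one]
    simpa only [zpowGroupHom_apply, map_zpow] using h

theorem toHNN_bsa (hc : c ≠ 0) (he : e ≠ 0) : toHNN hc he (bsa c e) = t :=
  PresentedGroup.toGroup.of _

theorem toHNN_bsb (hc : c ≠ 0) (he : e ≠ 0) : toHNN hc he (bsb c e) = of (ofAdd 1) :=
  PresentedGroup.toGroup.of _

/-- The list of pairs `(1, g)` of the reduced word of `a b^{i₀} a b^{i₁} ⋯ a b^p`. -/
def syllables : List ℤ → ℤ → List (ℤˣ × Multiplicative ℤ)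
  | [], p => [(1, ofAdd p)]
  | i :: l, p => (1, ofAdd i) :: syllables l p

theorem fst_of_mem_syllables {l : List ℤ} {p : ℤ} {x : ℤˣ × Multiplicative ℤ}
    (h : x ∈ syllables l p) : x.1 = 1 := by
  induction l with
  | nil => simp_all [syllables]
  | cons i l ih =>
    rcases List.mem_cons.1 h with rfl | h
    · rfl
    · exact ih h

/-- The reduced word of `b^i a b^{i₀} a b^{i₁} ⋯ a b^p`. -/
def reducedWord (A B : Subgroup (Multiplicative ℤ)) (i : ℤ) (l : List ℤ) (p : ℤ) :
    NormalWord.ReducedWord (Multiplicative ℤ) A B where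
  head := ofAdd i
  toList := syllables l p
  chain := by
    refine List.Pairwise.isChain (List.Pairwise.imp_of_mem (R := fun _ _ => True) ?_ ?_)
    · intro x y hx hy _ _
      rw [fst_of_mem_syllables hx, fst_of_mem_syllables hy]
    · exact List.pairwise_of_forall fun _ _ => trivial

theorem toHNN_stemProd (hc : c ≠ 0) (he : e ≠ 0) (i : ℤ) (l : List ℤ) (p : ℤ) :
    toHNN hc he (stemProd c e (i :: l) * bsb c e ^ p) =
      (reducedWord _ _ i l p).prod (associatedEquiv hc he) := by
  have hb (n : ℤ) : toHNN hc he (bsb c e) ^ n = of (ofAdd n) := by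
    rw [toHNN_bsb, ← map_zpow, ← ofAdd_zsmul]
    simp
  induction l generalizing i with
  | nil =>
    simp [NormalWord.ReducedWord.prod, reducedWord, syllables, hb, toHNN_bsa, mul_assoc]
  | cons j l ih =>
    rw [stemProd_cons, mul_assoc, map_mul, ih]
    simp [NormalWord.ReducedWord.prod, reducedWord, syllables, hb, toHNN_bsa, mul_assoc]

theorem dvd_sub_of_stemProd_eq (hc : c ≠ 0) (he : e ≠ 0) {i j p q : ℤ} {l m : List ℤ}
    (h : stemProd c e (i :: l) * bsb c e ^ p = stemProd c e (j :: m) * bsb c e ^ q) :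
    e ∣ j - i := by
  have h' := congrArg (toHNN hc he) h
  rw [toHNN_stemProd, toHNN_stemProd] at h'
  have h₂ := (HNNExtension.ReducedWord.map_fst_eq_and_of_prod_eq _ h').2 1
    (by cases l <;> simp [reducedWord, syllables])
  obtain ⟨x, hx⟩ := h₂
  refine ⟨toAdd x, ?_⟩
  have := congrArg toAdd hx
  simp [reducedWord] at this
  lia

theorem length_syllables (l : List ℤ) (p : ℤ) : (syllables l p).length = l.length + 1 := by
  induction l with
  | nil => rfl
  | cons i l ih => simp [syllables, ih]

theorem length_eq_of_stemProd_eq (hc : c ≠ 0) (he : e ≠ 0) {p q : ℤ} {l m : List ℤ}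
    (h : stemProd c e l * bsb c e ^ p = stemProd c e m * bsb c e ^ q) :
    l.length = m.length := by
  have h' : stemProd c e (0 :: l) * bsb c e ^ p = stemProd c e (0 :: m) * bsb c e ^ q := by
    simp only [stemProd_cons, mul_assoc, h]
  have h₂ := congrArg (toHNN hc he) h'
  rw [toHNN_stemProd, toHNN_stemProd] at h₂
  have h₃ := congrArg List.length
    (HNNExtension.ReducedWord.map_fst_eq_and_of_prod_eq _ h₂).1
  simpa [reducedWord, length_syllables] using h₃

end Britton

theorem eq_of_stemProd_eq (hc : 0 < c) (hd : 0 < d) (he : e = d ∨ e = -d) {l m : List ℤ}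
    (hl : ∀ i ∈ l, i ∈ Set.Ico 0 d) (hm : ∀ i ∈ m, i ∈ Set.Ico 0 d) {p q : ℤ}
    (h : stemProd c e l * bsb c e ^ p = stemProd c e m * bsb c e ^ q) : l = m := by
  have he₀ : e ≠ 0 := by lia
  induction l generalizing m with
  | nil =>
    have := length_eq_of_stemProd_eq hc.ne' he₀ h
    exact (List.length_eq_zero_iff.1 this.symm).symm
  | cons i l ih =>
    have hlen := length_eq_of_stemProd_eq hc.ne' he₀ h
    cases m with
    | nil => simp at hlen
    | cons j m =>
      have hdvd : d ∣ j - i :=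
        (show d ∣ e by rcases he with rfl | rfl <;> simp).trans
          (dvd_sub_of_stemProd_eq hc.ne' he₀ h)
      obtain ⟨hi₀, hi₁⟩ := hl i (by simp)
      obtain ⟨hj₀, hj₁⟩ := hm j (by simp)
      have hij : j - i = 0 := Int.eq_zero_of_abs_lt_dvd hdvd (by rw [abs_lt]; lia)
      obtain rfl : i = j := by lia
      simp only [stemProd_cons, mul_assoc, mul_left_cancel_iff] at h
      rw [ih (fun k hk => hl k (by simp [hk])) (fun k hk => hm k (by simp [hk])) h]

theorem exists_stemProd_mul_eq (hc : 0 < c) (hd : 0 < d) (he : e = d ∨ e = -d)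
    {γ : BSGroup c e} (hγ : γ ∈ bsΛ c e) (l : List ℤ) (p : ℤ) :
    ∃ (m : List ℤ) (q : ℤ), stemProd c e l * bsb c e ^ p * γ = stemProd c e (l ++ m) * bsb c e ^ q ∧
      (∀ i ∈ m, i ∈ Set.Ico 0 d) ∧ (e = d → 0 ≤ p → 0 ≤ q) := by
  induction hγ using Submonoid.closure_induction_right with
  | one => exact ⟨[], p, by simp, by simp, fun _ h => h⟩
  | mul_right x _ y hy ih =>
    obtain ⟨m, q, hx, hm, hq⟩ := ih
    rw [← mul_assoc, hx]
    rcases hy with rfl | rfl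
    · obtain ⟨r, hr, hr'⟩ : ∃ r, q = q % d + e * r ∧ (e = d → r = q / d) := by
        have := Int.emod_add_mul_ediv q d
        rcases he with rfl | rfl
        · exact ⟨q / e, by lia, fun _ => rfl⟩
        · exact ⟨-(q / d), by lia, by lia⟩
      refine ⟨m ++ [q % d], c * r, ?_, ?_, ?_⟩
      · rw [← List.append_assoc, ← stemProd_mul_bsb_zpow_mul_bsa, ← hr]
      · intro i hi
        rcases List.mem_append.1 hi with hi | hi
        · exact hm i hi
        · rw [List.mem_singleton.1 hi]
          exact ⟨Int.emod_nonneg _ hd.ne', Int.emod_lt_of_pos _ hd⟩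
      · intro h hp
        rw [hr' h]
        exact mul_nonneg hc.le (Int.ediv_nonneg (hq h hp) hd.le)
    · exact ⟨m, q + 1, by rw [mul_assoc, ← zpow_add_one], hm, fun h hp => by have := hq h hp; lia⟩

theorem exists_eq_stemProd_mul (hc : 0 < c) (hd : 0 < d) (he : e = d ∨ e = -d)
    {x : BSGroup c e} (hx : x ∈ bsΛ c e) :
    ∃ (l : List ℤ) (p : ℤ), x = stemProd c e l * bsb c e ^ p ∧
      (∀ i ∈ l, i ∈ Set.Ico 0 d) ∧ (e = d → 0 ≤ p) := by
  obtain ⟨l, p, h, hl, hp⟩ := exists_stemProd_mul_eq hc hd he hx [] 0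
  exact ⟨l, p, by simpa using h, hl, fun h => hp h le_rfl⟩

theorem isPrefix_of_precedes (hc : 0 < c) (hd : 0 < d) (he : e = d ∨ e = -d) {l m : List ℤ}
    (hl : ∀ i ∈ l, i ∈ Set.Ico 0 d) (hm : ∀ i ∈ m, i ∈ Set.Ico 0 d) {p q : ℤ}
    (h : Precedes (stemProd c e l * bsb c e ^ p) (stemProd c e m * bsb c e ^ q)) : l <+: m := by
  obtain ⟨γ, hγ, h⟩ := h
  obtain ⟨k, r, hk, hk', -⟩ := exists_stemProd_mul_eq hc hd he hγ l p
  rw [hk] at h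
  rw [eq_of_stemProd_eq hc hd he hm
    (fun i hi => (List.mem_append.1 hi).elim (hl i) (hk' i)) h]
  exact List.prefix_append l k

theorem precedes_concat_of_le {i p q : ℤ} (l : List ℤ) (h : p ≤ i + e * q) :
    Precedes (stemProd c e l * bsb c e ^ p) (stemProd c e (l ++ [i]) * bsb c e ^ (c * q)) := by
  rw [← stemProd_mul_bsb_zpow_mul_bsa]
  exact (precedes_mul_bsb_zpow _ h).trans ⟨_, bsa_mem, rfl⟩

theorem exists_precedes_concat (hd : 0 < d) (he : e = d ∨ e = -d) (l : List ℤ)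
    (i p : ℤ) : ∃ r : ℕ,
      Precedes (stemProd c e l * bsb c e ^ p) (stemProd c e (l ++ [i]) * bsb c e ^ r) := by
  have hn : p ≤ i + d * |p - i| := by
    have := mul_le_mul_of_nonneg_right (show 1 ≤ d by lia) (abs_nonneg (p - i))
    have := le_abs_self (p - i)
    lia
  obtain ⟨q, hq⟩ : ∃ q, p ≤ i + e * q := by
    rcases he with rfl | rfl
    · exact ⟨_, hn⟩
    · exact ⟨-|p - i|, by simpa using hn⟩
  refine ⟨(c * q).toNat, (precedes_concat_of_le l hq).trans ?_⟩
  rw [← zpow_natCast]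
  exact precedes_mul_bsb_zpow _ (Int.self_le_toNat _)

theorem stemProd_precedes_concat (hc : 0 < c) (hd : 0 < d) (he : e = d ∨ e = -d) (l : List ℤ)
    {i p : ℤ} (hi : 0 ≤ i) (hp : e = d → 0 ≤ p) :
    Precedes (stemProd c e l) (stemProd c e (l ++ [i]) * bsb c e ^ p) := by
  obtain ⟨q, hq, hq'⟩ : ∃ q, 0 ≤ e * q ∧ c * q ≤ p := by
    rcases he with rfl | rfl
    · exact ⟨0, by simp, by simpa using hp rfl⟩
    · refine ⟨-|p|, by rw [neg_mul_neg]; positivity, ?_⟩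
      have := mul_le_mul_of_nonneg_right (show 1 ≤ c by lia) (abs_nonneg p)
      have := neg_abs_le p
      lia
  have h := precedes_concat_of_le (c := c) (i := i) (p := 0) l (show 0 ≤ i + e * q by lia)
  rw [zpow_zero, mul_one] at h
  exact h.trans (precedes_mul_bsb_zpow _ hq')

theorem stemProd_precedes_of_isPrefix {l m : List ℤ} (hm : ∀ i ∈ m, i ∈ Set.Ico 0 d)
    (h : l <+: m) : Precedes (stemProd c e l) (stemProd c e m) := by
  obtain ⟨k, rfl⟩ := h
  exact ⟨_, stemProd_mem fun i hi => hm i (by simp [hi]), stemProd_append l k⟩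

section InitialList

variable (i : BSSeq d)

@[simp]
theorem length_initialList (n : ℕ) : (initialList i n).length = n := by simp [initialList]

@[simp]
theorem getElem_initialList {n k : ℕ} (h : k < (initialList i n).length) :
    (initialList i n)[k] = i k := by simp [initialList]

theorem mem_Ico_of_mem_initialList {n : ℕ} : ∀ j ∈ initialList i n, j ∈ Set.Ico 0 d := by
  intro j hj
  obtain ⟨k, -, rfl⟩ := List.mem_map.1 hj
  exact (i k).2

theorem initialList_succ (n : ℕ) : initialList i (n + 1) = initialList i n ++ [(i n : ℤ)] := by
  simp [initialList, List.range_succ]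

theorem initialList_isPrefix {m n : ℕ} (h : m ≤ n) : initialList i m <+: initialList i n := by
  induction n, h using Nat.le_induction with
  | base => exact List.prefix_rfl
  | succ n _ ih => exact ih.trans (initialList_succ i n ▸ List.prefix_append _ _)

theorem eq_initialList {l : List ℤ} (h : ∀ k (hk : k < l.length), l[k] = i k) :
    l = initialList i l.length :=
  List.ext_getElem (by simp) fun k hk _ => by simp [h k hk]

theorem alphaSeq_eq (k : ℕ) : alphaSeq c e d i k = stemProd c e (initialList i (k + 1)) := by
  rw [alphaSeq, stemProd]
  congr 1
  exact List.ext_getElem (by simp) fun _ _ _ => by simp [-List.ofFn_succ]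

theorem alphaSeq_mem (k : ℕ) : alphaSeq c e d i k ∈ bsΛ c e :=
  alphaSeq_eq (c := c) (e := e) i k ▸ stemProd_mem (mem_Ico_of_mem_initialList i)

theorem alphaSeq_precedes {m n : ℕ} (h : m ≤ n) :
    Precedes (alphaSeq c e d i m) (alphaSeq c e d i n) := by
  rw [alphaSeq_eq, alphaSeq_eq]
  exact stemProd_precedes_of_isPrefix (mem_Ico_of_mem_initialList i)
    (initialList_isPrefix i (by lia))

theorem exists_precedes_initialList (hd : 0 < d) (he : e = d ∨ e = -d) {m n : ℕ}
    (h : m ≤ n) (p : ℕ) : ∃ r : ℕ, Precedes (stemProd c e (initialList i m) * bsb c e ^ p)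
      (stemProd c e (initialList i n) * bsb c e ^ r) := by
  induction n, h using Nat.le_induction with
  | base => exact ⟨p, Precedes.refl _⟩
  | succ n _ ih =>
    obtain ⟨r, hr⟩ := ih
    obtain ⟨s, hs⟩ := exists_precedes_concat hd he (initialList i n) (i n) r
    rw [zpow_natCast, ← initialList_succ] at hs
    exact ⟨s, hr.trans hs⟩

end InitialList

theorem isDH_iUnion_seg {ι : Type*} [Nonempty ι] {f : ι → BSGroup c e}
    (hf : ∀ i, f i ∈ bsΛ c e) (hdir : Directed Precedes f) : IsDH c e (⋃ i, seg c e (f i)) := by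
  refine ⟨?_, ?_, ?_, ?_⟩
  · obtain ⟨i⟩ := ‹Nonempty ι›
    exact ⟨f i, Set.mem_iUnion.2 ⟨i, hf i, Precedes.refl _⟩⟩
  · intro x hx
    obtain ⟨i, hx, -⟩ := Set.mem_iUnion.1 hx
    exact hx
  · intro x hx y hy
    obtain ⟨i, -, hx⟩ := Set.mem_iUnion.1 hx
    obtain ⟨j, -, hy⟩ := Set.mem_iUnion.1 hy
    obtain ⟨k, hik, hjk⟩ := hdir i j
    exact ⟨f k, Set.mem_iUnion.2 ⟨k, hf k, Precedes.refl _⟩, Precedes.trans hx hik,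
      Precedes.trans hy hjk⟩
  · intro y hy x hx hxy
    obtain ⟨i, -, hy⟩ := Set.mem_iUnion.1 hy
    exact Set.mem_iUnion.2 ⟨i, hx, Precedes.trans hxy hy⟩

theorem isDH_C0 (i : BSSeq d) : IsDH c e (C0 c e d i) :=
  isDH_iUnion_seg (alphaSeq_mem i) fun m n =>
    ⟨max m n, alphaSeq_precedes i (le_max_left m n), alphaSeq_precedes i (le_max_right m n)⟩

theorem isDH_Cinf (hd : 0 < d) (he : e = d ∨ e = -d) (i : BSSeq d) :
    IsDH c e (Cinf c e d i) := by
  have h : Cinf c e d i = ⋃ kp : ℕ × ℕ, seg c e (alphaSeq c e d i kp.1 * bsb c e ^ kp.2) := by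
    rw [Cinf, Set.iUnion_prod']
  rw [h]
  refine isDH_iUnion_seg (fun kp => mul_mem (alphaSeq_mem i kp.1) (pow_mem bsb_mem kp.2)) ?_
  rintro ⟨k, p⟩ ⟨m, q⟩
  simp only [alphaSeq_eq]
  obtain ⟨r, hr⟩ := exists_precedes_initialList i hd he
    (Nat.succ_le_succ (le_max_left k m)) p
  obtain ⟨s, hs⟩ := exists_precedes_initialList i hd he
    (Nat.succ_le_succ (le_max_right k m)) q
  have h {u v : ℕ} (huv : u ≤ v) (x : BSGroup c e) :
      Precedes (x * bsb c e ^ u) (x * bsb c e ^ v) := by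
    simpa using precedes_mul_bsb_zpow x (Int.ofNat_le.2 huv)
  exact ⟨(max k m, max r s), hr.trans (h (le_max_left r s) _), hs.trans (h (le_max_right r s) _)⟩

theorem C0_subset_Cinf (i : BSSeq d) : C0 c e d i ⊆ Cinf c e d i :=
  Set.iUnion_mono fun _ => Set.subset_iUnion_of_subset 0 (by simp)

theorem exists_eq_of_mem_Cinf (hc : 0 < c) (hd : 0 < d) (he : e = d ∨ e = -d) {i : BSSeq d}
    {x : BSGroup c e} (hx : x ∈ Cinf c e d i) :
    ∃ (n : ℕ) (p : ℤ), x = stemProd c e (initialList i n) * bsb c e ^ p ∧ (e = d → 0 ≤ p) := by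
  simp only [Cinf, Set.mem_iUnion] at hx
  obtain ⟨k, q, hxΛ, hx⟩ := hx
  obtain ⟨l, p, rfl, hl, hp⟩ := exists_eq_stemProd_mul hc hd he hxΛ
  rw [alphaSeq_eq, ← zpow_natCast] at hx
  have h := isPrefix_of_precedes hc hd he hl (mem_Ico_of_mem_initialList i) hx
  have hli := eq_initialList i (l := l) fun k hk => by rw [h.getElem hk, getElem_initialList]
  rw [hli]
  exact ⟨_, p, rfl, hp⟩

theorem mem_Cinf (hd : 0 < d) (he : e = d ∨ e = -d) {i : BSSeq d} {n : ℕ} {p : ℤ}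
    (hx : stemProd c e (initialList i n) * bsb c e ^ p ∈ bsΛ c e) :
    stemProd c e (initialList i n) * bsb c e ^ p ∈ Cinf c e d i := by
  obtain ⟨r, hr⟩ := exists_precedes_concat hd he (initialList i n) (i n) p
  simp only [Cinf, Set.mem_iUnion]
  rw [← initialList_succ, ← alphaSeq_eq] at hr
  exact ⟨n, r, hx, hr⟩

theorem eq_of_getElem_eq_of_mem {C : Set (BSGroup c e)} (hc : 0 < c) (hd : 0 < d)
    (he : e = d ∨ e = -d) (hC : IsDH c e C) {l m : List ℤ} (hl : ∀ i ∈ l, i ∈ Set.Ico 0 d)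
    (hm : ∀ i ∈ m, i ∈ Set.Ico 0 d) {p q : ℤ} (hlC : stemProd c e l * bsb c e ^ p ∈ C)
    (hmC : stemProd c e m * bsb c e ^ q ∈ C) {n : ℕ} (hnl : n < l.length) (hnm : n < m.length) :
    l[n] = m[n] := by
  obtain ⟨z, hz, hlz, hmz⟩ := hC.2.2.1 _ hlC _ hmC
  obtain ⟨k, r, rfl, hk, -⟩ := exists_eq_stemProd_mul hc hd he (hC.2.1 z hz)
  rw [(isPrefix_of_precedes hc hd he hl hk hlz).getElem hnl,
    (isPrefix_of_precedes hc hd he hm hk hmz).getElem hnm]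

theorem exists_subset_Cinf {C : Set (BSGroup c e)} (hc : 0 < c) (hd : 0 < d)
    (he : e = d ∨ e = -d) (hC : IsDH c e C) : ∃ i : BSSeq d, C ⊆ Cinf c e d i := by
  have h (n : ℕ) : ∃ z : Set.Ico (0 : ℤ) d, ∀ (l : List ℤ) (p : ℤ),
      (∀ i ∈ l, i ∈ Set.Ico 0 d) → stemProd c e l * bsb c e ^ p ∈ C →
        ∀ hn : n < l.length, l[n] = z := by
    by_cases hex : ∃ (l : List ℤ) (p : ℤ), (∀ i ∈ l, i ∈ Set.Ico 0 d) ∧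
        stemProd c e l * bsb c e ^ p ∈ C ∧ n < l.length
    · obtain ⟨m, q, hm, hmC, hn⟩ := hex
      exact ⟨⟨m[n], hm _ (List.getElem_mem hn)⟩, fun l p hl hlC hnl =>
        eq_of_getElem_eq_of_mem hc hd he hC hl hm hlC hmC hnl hn⟩
    · exact ⟨⟨0, le_rfl, hd⟩, fun l p hl hlC hnl => (hex ⟨l, p, hl, hlC, hnl⟩).elim⟩
  choose i hi using h
  refine ⟨i, fun x hx => ?_⟩
  have hxΛ := hC.2.1 x hx
  obtain ⟨l, p, rfl, hl, -⟩ := exists_eq_stemProd_mul hc hd he hxΛ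
  rw [eq_initialList i fun k hk => hi k l p hl hx hk] at hxΛ ⊢
  exact mem_Cinf hd he hxΛ

section Unbounded

variable {θ : BSGroup c e → ℤ} {C : Set (BSGroup c e)}

theorem eq_of_subset_Cinf (hc : 0 < c) (hd : 0 < d) (he : e = d ∨ e = -d)
    (hθ : ∀ x y, θ (x * y) = θ x + θ y) (hθa : θ (bsa c e) = 1) (hθb : θ (bsb c e) = 0)
    (hC : ∀ B : ℤ, ∃ x ∈ C, B < θ x) {i j : BSSeq d} (hi : C ⊆ Cinf c e d i)
    (hj : C ⊆ Cinf c e d j) : i = j := by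
  funext k
  obtain ⟨x, hx, hk⟩ := hC k
  obtain ⟨m, p, rfl, -⟩ := exists_eq_of_mem_Cinf hc hd he (hi hx)
  obtain ⟨n, q, h, -⟩ := exists_eq_of_mem_Cinf hc hd he (hj hx)
  have h' := eq_of_stemProd_eq hc hd he (mem_Ico_of_mem_initialList i)
    (mem_Ico_of_mem_initialList j) h
  rw [height_stemProd_mul hθ hθa hθb, length_initialList] at hk
  have hm : k < (initialList i m).length := by simpa using hk
  have hn : k < (initialList j n).length := h' ▸ hm
  have := List.getElem_of_eq h' hm
  rw [getElem_initialList, getElem_initialList] at this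
  exact Subtype.ext this

theorem exists_mem_Cinf_lt_height (hd : 0 < d) (he : e = d ∨ e = -d)
    (hθ : ∀ x y, θ (x * y) = θ x + θ y) (hθa : θ (bsa c e) = 1) (hθb : θ (bsb c e) = 0)
    (i : BSSeq d) (B : ℤ) : ∃ x ∈ Cinf c e d i, B < θ x := by
  refine ⟨stemProd c e (initialList i (B.toNat + 1)) * bsb c e ^ (0 : ℤ),
    mem_Cinf hd he ?_, ?_⟩
  · exact mul_mem (stemProd_mem (mem_Ico_of_mem_initialList i)) (bsb_zpow_mem le_rfl)
  · rw [height_stemProd_mul hθ hθa hθb, length_initialList]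
    lia

theorem C0_subset_of_subset_Cinf (hc : 0 < c) (hd : 0 < d) (he : e = d ∨ e = -d)
    (hθ : ∀ x y, θ (x * y) = θ x + θ y) (hθa : θ (bsa c e) = 1) (hθb : θ (bsb c e) = 0)
    (hCdh : IsDH c e C) (hC : ∀ B : ℤ, ∃ x ∈ C, B < θ x) {i : BSSeq d}
    (hi : C ⊆ Cinf c e d i) : C0 c e d i ⊆ C := by
  intro y hy
  obtain ⟨k, hyΛ, hy⟩ := Set.mem_iUnion.1 hy
  obtain ⟨x, hx, hk⟩ := hC (k + 1)
  obtain ⟨n, p, rfl, hp⟩ := exists_eq_of_mem_Cinf hc hd he (hi hx)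
  rw [height_stemProd_mul hθ hθa hθb, length_initialList] at hk
  obtain ⟨m, rfl⟩ : ∃ m, n = m + 1 := ⟨n - 1, by lia⟩
  rw [initialList_succ] at hx
  refine hCdh.2.2.2 _ hx y hyΛ (Precedes.trans hy (Precedes.trans ?_
    (stemProd_precedes_concat hc hd he _ (i m).2.1 hp)))
  rw [alphaSeq_eq]
  exact stemProd_precedes_of_isPrefix (mem_Ico_of_mem_initialList i)
    (initialList_isPrefix i (by lia))

end Unbounded

end BaumslagSolitar

open BaumslagSolitar

/-- For each `i ∈ [0,d)^ℕ`, `C₀(i)` and `C_∞(i)` are (nonempty) directed hereditary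
subsets of `Λ` with `C₀(i) ⊆ C_∞(i)`; the maximal nonempty directed hereditary subsets of
`Λ` are exactly the `C_∞(i)`; and every directed hereditary `C` on which the height `θ` is
unbounded satisfies `C ⊆ C_∞(i)` for a unique `i`, and `C₀(i) ⊆ C` for that `i`. -/
theorem statement15 (c d : ℤ) (hc : 0 < c) (hd : 0 < d) (e : ℤ) (he : e = d ∨ e = -d)
    (θ : BSGroup c e → ℤ) (hθ : ∀ x y, θ (x * y) = θ x + θ y)
    (hθa : θ (bsa c e) = 1) (hθb : θ (bsb c e) = 0) :
    (∀ i : BSSeq d,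
      IsDH c e (C0 c e d i) ∧ IsDH c e (Cinf c e d i) ∧ C0 c e d i ⊆ Cinf c e d i) ∧
    (∀ C : Set (BSGroup c e),
      (IsDH c e C ∧ ∀ C' : Set (BSGroup c e), IsDH c e C' → C ⊆ C' → C = C') ↔
      ∃ i : BSSeq d, C = Cinf c e d i) ∧
    (∀ C : Set (BSGroup c e), IsDH c e C → (∀ B : ℤ, ∃ x ∈ C, B < θ x) →
      (∃! i : BSSeq d, C ⊆ Cinf c e d i) ∧
      (∀ i : BSSeq d, C ⊆ Cinf c e d i → C0 c e d i ⊆ C)) := by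
  refine ⟨fun i => ⟨isDH_C0 i, isDH_Cinf hd he i, C0_subset_Cinf i⟩,
    fun C => ⟨?_, ?_⟩, fun C hC hub => ⟨?_, fun i hi => ?_⟩⟩
  · rintro ⟨hC, hmax⟩
    obtain ⟨i, hi⟩ := exists_subset_Cinf hc hd he hC
    exact ⟨i, hmax _ (isDH_Cinf hd he i) hi⟩
  · rintro ⟨i, rfl⟩
    refine ⟨isDH_Cinf hd he i, fun C' hC' hsub => ?_⟩
    obtain ⟨j, hj⟩ := exists_subset_Cinf hc hd he hC'
    obtain rfl := eq_of_subset_Cinf hc hd he hθ hθa hθb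
      (exists_mem_Cinf_lt_height hd he hθ hθa hθb i) subset_rfl (hsub.trans hj)
    exact hsub.antisymm hj
  · obtain ⟨i, hi⟩ := exists_subset_Cinf hc hd he hC
    exact ⟨i, hi, fun j hj => eq_of_subset_Cinf hc hd he hθ hθa hθb hub hj hi⟩
  · exact C0_subset_of_subset_Cinf hc hd he hθ hθa hθb hC hub hi
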